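/- Let d ≥ 1, 0 < α < d, and 1 < s ≤ d/α. Then there exists a constant C = C(d,α,s) > 0 such that for every measurable weight w : ℝ^d → (0,∞) with finite Morrey–Campanato norm ‖w‖_{𝓛^{α,s}} and every measurable f : ℝ^d → ℂ: ( ∫_{ℝ^d} |(I_α f)(x)|² w(x) dx )^(1/2) ≤ C · ‖w‖_{𝓛^{α,s}} · ( ∫_{ℝ^d} |f(x)|² w(x)^{−1} dx )^(1/2), where I_α f(x) := ∫_{ℝ^d} |x−y|^{−d+α} f(y) dy is the Riesz potential of order α (the inequality being understood with the convention that it holds whenever the right-hand side is finite). -/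

import Mathlib

open MeasureTheory Metric ENNReal NNReal

/-- The Morrey–Campanato norm of a real-valued function, valued in `ℝ≥0∞`:
`sup_{x, r>0} r^α ( r^{-d} ∫_{B_r(x)} |V|^p )^{1/p}`. -/
noncomputable def morreyNorm (d : ℕ) (α p : ℝ) (w : EuclideanSpace ℝ (Fin d) → ℝ) : ℝ≥0∞ :=
  ⨆ (x : EuclideanSpace ℝ (Fin d)) (r : ℝ) (_ : 0 < r),
    ENNReal.ofReal r ^ α *
      (ENNReal.ofReal r ^ (-(d : ℝ)) *
        ∫⁻ y in Metric.ball x r, ENNReal.ofReal (|w y| ^ p)) ^ (1 / p)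
/-- The Riesz potential of order `α`: `I_α f (x) = ∫ |x-y|^{-d+α} f(y) dy`. -/
noncomputable def rieszPotential (d : ℕ) (α : ℝ) (f : EuclideanSpace ℝ (Fin d) → ℂ)
    (x : EuclideanSpace ℝ (Fin d)) : ℂ :=
  ∫ y, ((‖x - y‖ ^ (-(d : ℝ) + α) : ℝ) : ℂ) * f y

section

open Set

theorem lintegral_Ioc_rpow_sub_one {p R : ℝ} (hp : 0 < p) (hR : 0 < R) :
    ∫⁻ t in Ioc 0 R, ENNReal.ofReal (t ^ (p - 1)) = ENNReal.ofReal (R ^ p / p) := by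
  have hi : IntervalIntegrable (fun t : ℝ ↦ t ^ (p - 1)) volume 0 R :=
    intervalIntegral.intervalIntegrable_rpow' (by linarith)
  rw [← ofReal_integral_eq_lintegral_ofReal, ← intervalIntegral.integral_of_le hR.le,
    integral_rpow (Or.inl (by linarith))]
  · simp [Real.zero_rpow hp.ne']
  · exact (intervalIntegrable_iff_integrableOn_Ioc_of_le hR.le).1 hi
  · filter_upwards [ae_restrict_mem measurableSet_Ioc] with t ht
    exact Real.rpow_nonneg ht.1.le _

theorem lintegral_Ioi_rpow_neg_sub_one {p R : ℝ} (hp : 0 < p) (hR : 0 < R) :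
    ∫⁻ t in Ioi R, ENNReal.ofReal (t ^ (-p - 1)) = ENNReal.ofReal (R ^ (-p) / p) := by
  rw [← ofReal_integral_eq_lintegral_ofReal, integral_Ioi_rpow_of_lt (by linarith) hR]
  · congr 1
    rw [sub_add_cancel, neg_div_neg_eq]
  · exact integrableOn_Ioi_rpow_of_lt (by linarith) hR
  · filter_upwards [ae_restrict_mem measurableSet_Ioi] with t ht
    exact Real.rpow_nonneg (hR.le.trans ht.le) _

/-- The Riesz potential of a nonnegative function, up to a constant, as an integral of its masses
on balls. -/
noncomputable def layerPotential (d : ℕ) (α : ℝ) (v : EuclideanSpace ℝ (Fin d) → ℝ≥0∞)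
    (x : EuclideanSpace ℝ (Fin d)) : ℝ≥0∞ :=
  ∫⁻ t in Ioi (0 : ℝ), ENNReal.ofReal (t ^ (α - d - 1)) * ∫⁻ z in ball x t, v z

variable {d : ℕ} {α : ℝ} {v : EuclideanSpace ℝ (Fin d) → ℝ≥0∞}

theorem Measurable.indicator_ball {β : Type*} [MeasurableSpace β] (hv : Measurable v)
    {c z : β → EuclideanSpace ℝ (Fin d)} {r : β → ℝ} (hc : Measurable c) (hr : Measurable r)
    (hz : Measurable z) : Measurable fun b ↦ (ball (c b) (r b)).indicator v (z b) :=
  (hv.comp hz).indicator (measurableSet_lt (hz.dist hc) hr)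

theorem measurable_lintegral_ball (hv : Measurable v) :
    Measurable fun q : EuclideanSpace ℝ (Fin d) × ℝ ↦ ∫⁻ z in ball q.1 q.2, v z := by
  simp_rw [← lintegral_indicator measurableSet_ball]
  exact (hv.indicator_ball (measurable_fst.comp measurable_fst)
    (measurable_snd.comp measurable_fst) measurable_snd).lintegral_prod_right'

theorem measurable_lintegral_ball_left (hv : Measurable v) (τ : ℝ) :
    Measurable fun y : EuclideanSpace ℝ (Fin d) ↦ ∫⁻ z in ball y τ, v z := by
  simp_rw [← lintegral_indicator measurableSet_ball]
  exact (hv.indicator_ball measurable_fst measurable_const measurable_snd).lintegral_prod_right'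

theorem measurable_ofReal_rpow_mul_lintegral_ball (p : ℝ) (hv : Measurable v) :
    Measurable fun q : EuclideanSpace ℝ (Fin d) × ℝ ↦
      ENNReal.ofReal (q.2 ^ p) * ∫⁻ z in ball q.1 q.2, v z :=
  (measurable_snd.pow_const p).ennreal_ofReal.mul (measurable_lintegral_ball hv)

theorem measurable_layerPotential (hv : Measurable v) : Measurable (layerPotential d α v) :=
  (measurable_ofReal_rpow_mul_lintegral_ball _ hv).lintegral_prod_right'

theorem lintegral_rpow_mul_le_layerPotential (hαd : α < d) (hv : Measurable v)
    (x : EuclideanSpace ℝ (Fin d)) :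
    ∫⁻ y, ENNReal.ofReal (‖x - y‖ ^ (-(d : ℝ) + α)) * v y ≤
      ENNReal.ofReal (d - α) * layerPotential d α v x := by
  have hm : Measurable fun q : ℝ × EuclideanSpace ℝ (Fin d) ↦
      ENNReal.ofReal (q.1 ^ (α - d - 1)) * (ball x q.1).indicator v q.2 :=
    (measurable_fst.pow_const _).ennreal_ofReal.mul
      (hv.indicator_ball measurable_const measurable_fst measurable_snd)
  have heq : layerPotential d α v x =
      ∫⁻ y, ∫⁻ t in Ioi (0 : ℝ), ENNReal.ofReal (t ^ (α - d - 1)) * (ball x t).indicator v y := by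
    rw [← lintegral_lintegral_swap (f := fun t y ↦
      ENNReal.ofReal (t ^ (α - d - 1)) * (ball x t).indicator v y) hm.aemeasurable]
    refine lintegral_congr fun t ↦ ?_
    rw [lintegral_const_mul' _ _ ENNReal.ofReal_ne_top, lintegral_indicator measurableSet_ball]
  rw [heq, ← lintegral_const_mul' _ _ ENNReal.ofReal_ne_top]
  refine lintegral_mono fun y ↦ ?_
  rcases eq_or_ne x y with rfl | hxy
  · simp [Real.zero_rpow (by linarith : -(d : ℝ) + α ≠ 0)]
  have hρ : 0 < ‖x - y‖ := norm_sub_pos_iff.2 hxy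
  calc ENNReal.ofReal (‖x - y‖ ^ (-(d : ℝ) + α)) * v y
      = ENNReal.ofReal (d - α) *
        ∫⁻ t in Ioi ‖x - y‖, ENNReal.ofReal (t ^ (α - d - 1)) * v y := by
        have h := lintegral_Ioi_rpow_neg_sub_one (sub_pos.2 hαd) hρ
        rw [neg_sub] at h
        rw [lintegral_mul_const _ (by fun_prop), h, ← mul_assoc,
          ← ENNReal.ofReal_mul (sub_pos.2 hαd).le, mul_div_cancel₀ _ (sub_pos.2 hαd).ne',
          neg_add_eq_sub]
    _ = ENNReal.ofReal (d - α) * ∫⁻ t in Ioi ‖x - y‖,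
        ENNReal.ofReal (t ^ (α - d - 1)) * (ball x t).indicator v y := by
        congr 1
        refine setLIntegral_congr_fun measurableSet_Ioi fun t ht ↦ ?_
        have : y ∈ ball x t := by simpa [dist_eq_norm, norm_sub_rev] using ht
        simp [indicator_of_mem this]
    _ ≤ _ := by
        gcongr

theorem lintegral_ball_le_layerPotential (hαd : α < d) (x : EuclideanSpace ℝ (Fin d)) {t : ℝ}
    (ht : 0 < t) :
    ∫⁻ z in ball x t, v z ≤
      ENNReal.ofReal ((d - α) * t ^ ((d : ℝ) - α)) * layerPotential d α v x := by
  have h := lintegral_Ioi_rpow_neg_sub_one (sub_pos.2 hαd) ht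
  rw [neg_sub] at h
  have hp := sub_pos.2 hαd
  calc ∫⁻ z in ball x t, v z
      = ENNReal.ofReal ((d - α) * t ^ ((d : ℝ) - α)) *
        ∫⁻ τ in Ioi t, ENNReal.ofReal (τ ^ (α - d - 1)) * ∫⁻ z in ball x t, v z := by
        rw [lintegral_mul_const _ (by fun_prop), h, ← mul_assoc,
          ← ENNReal.ofReal_mul (by positivity)]
        have : (d - α) * t ^ ((d : ℝ) - α) * (t ^ (α - d) / (d - α)) = 1 := by
          rw [← neg_sub (d : ℝ) α, Real.rpow_neg ht.le]
          field_simp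
        rw [this]; simp
    _ ≤ ENNReal.ofReal ((d - α) * t ^ ((d : ℝ) - α)) *
        ∫⁻ τ in Ioi t, ENNReal.ofReal (τ ^ (α - d - 1)) * ∫⁻ z in ball x τ, v z := by
        gcongr 1
        refine setLIntegral_mono' measurableSet_Ioi fun τ hτ ↦ ?_
        gcongr
        exact hτ.le
    _ ≤ _ := by
        unfold layerPotential
        gcongr

theorem lintegral_ball_lintegral_ball_le (hv : Measurable v) (x : EuclideanSpace ℝ (Fin d))
    {t τ : ℝ} (hτ : 0 < τ) (hτt : τ ≤ t) :
    ∫⁻ y in ball x t, ∫⁻ z in ball y τ, v z ≤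
      volume (ball (0 : EuclideanSpace ℝ (Fin d)) 1) * ENNReal.ofReal (τ ^ (d : ℝ)) *
        ∫⁻ z in ball x (2 * t), v z := by
  have hm : Measurable fun q : EuclideanSpace ℝ (Fin d) × EuclideanSpace ℝ (Fin d) ↦
      (ball q.1 τ).indicator v q.2 :=
    hv.indicator_ball measurable_fst measurable_const measurable_snd
  calc ∫⁻ y in ball x t, ∫⁻ z in ball y τ, v z
      = ∫⁻ z, ∫⁻ y in ball x t, (ball y τ).indicator v z := by
        simp_rw [← lintegral_indicator (measurableSet_ball (ε := τ))]
        exact lintegral_lintegral_swap hm.aemeasurable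
    _ ≤ ∫⁻ z, volume (ball (0 : EuclideanSpace ℝ (Fin d)) 1) * ENNReal.ofReal (τ ^ (d : ℝ)) *
        (ball x (2 * t)).indicator v z := by
        refine lintegral_mono fun z ↦ ?_
        by_cases hz : z ∈ ball x (2 * t)
        · rw [indicator_of_mem hz]
          calc ∫⁻ y in ball x t, (ball y τ).indicator v z
              ≤ ∫⁻ y, (ball z τ).indicator (fun _ ↦ v z) y := by
                refine (setLIntegral_le_lintegral _ _).trans (lintegral_mono fun y ↦ le_of_eq ?_)
                simp [indicator, mem_ball, dist_comm]
            _ = _ := by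
                rw [lintegral_indicator_const measurableSet_ball,
                  Measure.addHaar_ball_of_pos volume z hτ, finrank_euclideanSpace_fin,
                  Real.rpow_natCast]
                ring
        · refine (le_of_eq (b := (0 : ℝ≥0∞)) ?_).trans zero_le
          rw [setLIntegral_congr_fun (g := fun _ ↦ 0) measurableSet_ball, lintegral_zero]
          intro y hy
          refine indicator_of_notMem (fun hzy ↦ hz ?_) _
          rw [mem_ball] at *
          linarith [dist_triangle z y x]
    _ = _ := by
        rw [lintegral_const_mul _ (hv.indicator measurableSet_ball),
          lintegral_indicator measurableSet_ball]

theorem lintegral_ball_layerPotential_le (hα : 0 < α) (hv : Measurable v)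
    (x : EuclideanSpace ℝ (Fin d)) {t : ℝ} (ht : 0 < t) :
    ∫⁻ y in ball x t, layerPotential d α v y ≤
      volume (ball (0 : EuclideanSpace ℝ (Fin d)) 1) *
        (ENNReal.ofReal (t ^ α / α) * (∫⁻ z in ball x (2 * t), v z) +
          ENNReal.ofReal (t ^ (d : ℝ)) *
            ∫⁻ τ in Ioi t, ENNReal.ofReal (τ ^ (α - d - 1)) * ∫⁻ z in ball x (2 * τ), v z) := by
  have hV : ∀ τ : ℝ, Measurable fun y : EuclideanSpace ℝ (Fin d) ↦ ∫⁻ z in ball y τ, v z :=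
    fun τ ↦ measurable_lintegral_ball_left hv τ
  have hswap : ∫⁻ y in ball x t, layerPotential d α v y =
      ∫⁻ τ in Ioi (0 : ℝ), ENNReal.ofReal (τ ^ (α - d - 1)) *
        ∫⁻ y in ball x t, ∫⁻ z in ball y τ, v z := by
    have hm := measurable_ofReal_rpow_mul_lintegral_ball (α - d - 1) hv
    calc _ = ∫⁻ τ in Ioi (0 : ℝ), ∫⁻ y in ball x t,
          ENNReal.ofReal (τ ^ (α - d - 1)) * ∫⁻ z in ball y τ, v z :=
          lintegral_lintegral_swap (f := fun y τ ↦ ENNReal.ofReal (τ ^ (α - d - 1)) *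
            ∫⁻ z in ball y τ, v z) hm.aemeasurable
      _ = _ := lintegral_congr fun τ ↦ lintegral_const_mul _ (hV τ)
  have hnear : ∫⁻ τ in Ioc 0 t, ENNReal.ofReal (τ ^ (α - d - 1)) *
        ∫⁻ y in ball x t, ∫⁻ z in ball y τ, v z ≤
      volume (ball (0 : EuclideanSpace ℝ (Fin d)) 1) *
        (ENNReal.ofReal (t ^ α / α) * ∫⁻ z in ball x (2 * t), v z) := by
    rw [← lintegral_Ioc_rpow_sub_one hα ht, ← lintegral_mul_const _ (by fun_prop),
      ← lintegral_const_mul' _ _ measure_ball_lt_top.ne]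
    refine setLIntegral_mono' measurableSet_Ioc fun τ hτ ↦ ?_
    calc _ ≤ _ := mul_le_mul_right (lintegral_ball_lintegral_ball_le hv x hτ.1 hτ.2) _
      _ = volume (ball (0 : EuclideanSpace ℝ (Fin d)) 1) *
          (ENNReal.ofReal (τ ^ (α - d - 1)) * ENNReal.ofReal (τ ^ (d : ℝ)) *
            ∫⁻ z in ball x (2 * t), v z) := by ring
      _ = _ := by
          rw [← ENNReal.ofReal_mul (Real.rpow_nonneg hτ.1.le _), ← Real.rpow_add hτ.1,
            show α - d - 1 + d = α - 1 by ring]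
  have hfar : ∫⁻ τ in Ioi t, ENNReal.ofReal (τ ^ (α - d - 1)) *
        ∫⁻ y in ball x t, ∫⁻ z in ball y τ, v z ≤
      volume (ball (0 : EuclideanSpace ℝ (Fin d)) 1) * (ENNReal.ofReal (t ^ (d : ℝ)) *
        ∫⁻ τ in Ioi t, ENNReal.ofReal (τ ^ (α - d - 1)) * ∫⁻ z in ball x (2 * τ), v z) := by
    rw [← lintegral_const_mul' _ _ ENNReal.ofReal_ne_top,
      ← lintegral_const_mul' _ _ measure_ball_lt_top.ne]
    refine setLIntegral_mono' measurableSet_Ioi fun τ hτ ↦ ?_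
    calc _ ≤ ENNReal.ofReal (τ ^ (α - d - 1)) *
          ∫⁻ y in ball x t, ∫⁻ z in ball x (2 * τ), v z := by
          gcongr 1
          refine setLIntegral_mono' measurableSet_ball fun y hy ↦ ?_
          refine lintegral_mono_set (ball_subset_ball' ?_)
          rw [mem_ball] at hy
          rw [mem_Ioi] at hτ
          linarith
      _ = _ := by
          rw [setLIntegral_const, Measure.addHaar_ball_of_pos volume x ht,
            finrank_euclideanSpace_fin, Real.rpow_natCast]
          ring
  rw [hswap, ← Ioc_union_Ioi_eq_Ioi ht.le,
    lintegral_union measurableSet_Ioi Ioc_disjoint_Ioi_same, mul_add]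
  exact add_le_add hnear hfar

theorem lintegral_Ioi_lintegral_ball_two_mul (x : EuclideanSpace ℝ (Fin d)) :
    ∫⁻ τ in Ioi (0 : ℝ), ENNReal.ofReal (τ ^ (α - d - 1)) * ∫⁻ z in ball x (2 * τ), v z =
      ENNReal.ofReal (2 ^ ((d : ℝ) - α)) * layerPotential d α v x := by
  have himg : (fun τ : ℝ ↦ 2 * τ) '' Ioi 0 = Ioi 0 := by
    rw [image_mul_left_Ioi two_pos, mul_zero]
  have h := lintegral_image_eq_lintegral_abs_deriv_mul (f := fun τ : ℝ ↦ 2 * τ)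
    (f' := fun _ ↦ 2) (s := Ioi 0) measurableSet_Ioi
    (fun τ _ ↦ by simpa using ((hasDerivAt_id τ).const_mul 2).hasDerivWithinAt)
    (mul_right_injective₀ two_ne_zero).injOn
    (fun t ↦ ENNReal.ofReal (t ^ (α - d - 1)) * ∫⁻ z in ball x t, v z)
  rw [himg] at h
  rw [layerPotential, h, ← lintegral_const_mul' _ _ ENNReal.ofReal_ne_top]
  refine setLIntegral_congr_fun measurableSet_Ioi fun τ hτ ↦ ?_
  rw [← mul_assoc, ← mul_assoc, ← ENNReal.ofReal_mul (by positivity),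
    ← ENNReal.ofReal_mul (by positivity), Real.mul_rpow two_pos.le (le_of_lt hτ), abs_two]
  congr 2
  have : (2 : ℝ) ^ ((d : ℝ) - α) * 2 * 2 ^ (α - d - 1) = 1 := by
    rw [← Real.rpow_add_one two_ne_zero, ← Real.rpow_add two_pos]
    ring_nf
    simp
  rw [← mul_assoc, this, one_mul]

theorem exists_lintegral_ball_layerPotential_le_mul (hα : 0 < α) (hαd : α < d) :
    ∃ C : ℝ, 0 < C ∧ ∀ v : EuclideanSpace ℝ (Fin d) → ℝ≥0∞, Measurable v → ∀ x t, 0 < t →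
      ∫⁻ y in ball x t, layerPotential d α v y ≤
        ENNReal.ofReal (C * t ^ (d : ℝ)) * layerPotential d α v x := by
  have hp := sub_pos.2 hαd
  set κ := volume (ball (0 : EuclideanSpace ℝ (Fin d)) 1)
  have hκ : κ ≠ ⊤ := measure_ball_lt_top.ne
  have hκ0 : 0 < κ.toReal := ENNReal.toReal_pos (measure_ball_pos _ _ one_pos).ne' hκ
  refine ⟨κ.toReal * ((d - α) * 2 ^ ((d : ℝ) - α) / α + 2 ^ ((d : ℝ) - α)), by positivity,
    fun v hv x t ht ↦ (lintegral_ball_layerPotential_le hα hv x ht).trans ?_⟩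
  calc _ ≤ κ * (ENNReal.ofReal (t ^ α / α) * (ENNReal.ofReal ((d - α) * (2 * t) ^ ((d : ℝ) - α)) *
          layerPotential d α v x) + ENNReal.ofReal (t ^ (d : ℝ)) *
          (ENNReal.ofReal (2 ^ ((d : ℝ) - α)) * layerPotential d α v x)) := by
        gcongr
        · exact lintegral_ball_le_layerPotential hαd x (by positivity)
        · rw [← lintegral_Ioi_lintegral_ball_two_mul]
          gcongr
    _ = ENNReal.ofReal (κ.toReal * (t ^ α / α * ((d - α) * (2 * t) ^ ((d : ℝ) - α)) +
          t ^ (d : ℝ) * 2 ^ ((d : ℝ) - α))) * layerPotential d α v x := by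
        rw [← mul_assoc, ← mul_assoc, ← ENNReal.ofReal_mul (by positivity),
          ← ENNReal.ofReal_mul (by positivity), ← add_mul,
          ← ENNReal.ofReal_add (by positivity) (by positivity), ← mul_assoc,
          ENNReal.ofReal_mul hκ0.le, ENNReal.ofReal_toReal hκ]
    _ = _ := by
        congr 2
        rw [Real.mul_rpow two_pos.le ht.le, Real.rpow_sub ht]
        field_simp

theorem exists_lintegral_ball_layerPotential_le_rpow {p : ℝ} (hα : 0 < α) (hαp : α < p) :
    ∃ C : ℝ, 0 < C ∧ ∀ v : EuclideanSpace ℝ (Fin d) → ℝ≥0∞, Measurable v → ∀ M : ℝ, 0 ≤ M →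
      (∀ x t, 0 < t → ∫⁻ y in ball x t, v y ≤ ENNReal.ofReal (M * t ^ (d - p))) → ∀ x t, 0 < t →
      ∫⁻ y in ball x t, layerPotential d α v y ≤ ENNReal.ofReal (C * M * t ^ (d + α - p)) := by
  have hp := sub_pos.2 hαp
  set κ := volume (ball (0 : EuclideanSpace ℝ (Fin d)) 1)
  have hκ : κ ≠ ⊤ := measure_ball_lt_top.ne
  have hκ0 : 0 < κ.toReal := ENNReal.toReal_pos (measure_ball_pos _ _ one_pos).ne' hκ
  refine ⟨κ.toReal * (2 ^ (d - p) / α + 2 ^ (d - p) / (p - α)), by positivity,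
    fun v hv M hM hvM x t ht ↦ (lintegral_ball_layerPotential_le hα hv x ht).trans ?_⟩
  have htail : ∫⁻ τ in Ioi t, ENNReal.ofReal (τ ^ (α - d - 1)) * ∫⁻ z in ball x (2 * τ), v z ≤
      ENNReal.ofReal (M * 2 ^ (d - p) * (t ^ (-(p - α)) / (p - α))) := by
    rw [ENNReal.ofReal_mul (by positivity), ← lintegral_Ioi_rpow_neg_sub_one hp ht,
      ← lintegral_const_mul' _ _ ENNReal.ofReal_ne_top]
    refine setLIntegral_mono' measurableSet_Ioi fun τ hτ ↦ ?_
    have hτ0 : 0 < τ := ht.trans hτ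
    calc _ ≤ ENNReal.ofReal (τ ^ (α - d - 1)) * ENNReal.ofReal (M * (2 * τ) ^ (d - p)) := by
          gcongr
          exact hvM x _ (by positivity)
      _ = _ := by
          rw [← ENNReal.ofReal_mul (by positivity), ← ENNReal.ofReal_mul (by positivity),
            Real.mul_rpow two_pos.le hτ0.le,
            show -(p - α) - 1 = (α - d - 1) + (d - p) by ring, Real.rpow_add hτ0]
          ring_nf
  calc _ ≤ κ * (ENNReal.ofReal (t ^ α / α) * ENNReal.ofReal (M * (2 * t) ^ (d - p)) +
          ENNReal.ofReal (t ^ (d : ℝ)) *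
            ENNReal.ofReal (M * 2 ^ (d - p) * (t ^ (-(p - α)) / (p - α)))) := by
        gcongr
        exact hvM x _ (by positivity)
    _ = ENNReal.ofReal (κ.toReal * (t ^ α / α * (M * (2 * t) ^ (d - p)) +
          t ^ (d : ℝ) * (M * 2 ^ (d - p) * (t ^ (-(p - α)) / (p - α))))) := by
        rw [← ENNReal.ofReal_mul (by positivity), ← ENNReal.ofReal_mul (by positivity),
          ← ENNReal.ofReal_add (by positivity) (by positivity),
          ENNReal.ofReal_mul hκ0.le, ENNReal.ofReal_toReal hκ]
    _ = _ := by
        congr 1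
        have h1 : t ^ α * t ^ (d - p) = t ^ (d + α - p) := by
          rw [← Real.rpow_add ht]; ring_nf
        have h2 : t ^ (d : ℝ) * t ^ (-(p - α)) = t ^ (d + α - p) := by
          rw [← Real.rpow_add ht]; ring_nf
        rw [Real.mul_rpow two_pos.le ht.le]
        calc _ = κ.toReal * ((t ^ α * t ^ (d - p)) * M * 2 ^ (d - p) / α +
              (t ^ (d : ℝ) * t ^ (-(p - α))) * M * 2 ^ (d - p) / (p - α)) := by ring
          _ = _ := by
            rw [h1, h2]; ring

theorem rpow_mul_rpow_le_ofReal {V W : ℝ≥0∞} {a b θ : ℝ} (ha : 0 ≤ a) (hb : 0 ≤ b)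
    (hθ : 0 ≤ θ) (hθ1 : θ ≤ 1) (hV : V ≤ ENNReal.ofReal a) (hW : W ≤ ENNReal.ofReal b) :
    V ^ θ * W ^ (1 - θ) ≤ ENNReal.ofReal (a ^ θ * b ^ (1 - θ)) := by
  have hθ' : 0 ≤ 1 - θ := sub_nonneg.2 hθ1
  rw [ENNReal.ofReal_mul (by positivity), ← ENNReal.ofReal_rpow_of_nonneg ha hθ,
    ← ENNReal.ofReal_rpow_of_nonneg hb hθ']
  gcongr

theorem lintegral_rpow_mul_le_of_growth {D s A n u : ℝ} (hα : 0 < α) (hs : 1 < s) (hA : 0 < A)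
    (hn : 0 < n) (hu : 0 < u) {V W : ℝ → ℝ≥0∞}
    (hVn : ∀ t, 0 < t → V t ≤ ENNReal.ofReal (A * n ^ s * t ^ (D - α * s)))
    (hVu : ∀ t, 0 < t → V t ≤ ENNReal.ofReal (A * u * t ^ (D - α)))
    (hWn : ∀ t, 0 < t → W t ≤ ENNReal.ofReal (A * n ^ s * t ^ (D + α - α * s)))
    (hWu : ∀ t, 0 < t → W t ≤ ENNReal.ofReal (A * u * t ^ D)) :
    ∫⁻ t in Ioi (0 : ℝ), ENNReal.ofReal (t ^ (α - D - 1)) * (V t ^ (1 / s) * W t ^ (1 - 1 / s)) ≤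
      ENNReal.ofReal (A * (1 / (α * (1 - 1 / s)) + 1 / (α * (s - 1) * (1 - 1 / s))) * n *
        u ^ (1 - 1 / s)) := by
  have hs0 : 0 < s := one_pos.trans hs
  have hs1 : 0 < s - 1 := sub_pos.2 hs
  have hθ1 : 1 / s < 1 := by rw [div_lt_one hs0]; exact hs
  have hθ' : 0 < 1 - 1 / s := sub_pos.2 hθ1
  have hθ : 0 < 1 / s := by positivity
  set e := α * (1 - 1 / s) with he
  set q := α * (s - 1) * (1 - 1 / s) with hq
  have he0 : 0 < e := by positivity
  have hq0 : 0 < q := by positivity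
  set R := (n ^ s / u) ^ (1 / (α * (s - 1))) with hR
  have hR0 : 0 < R := by positivity
  have hsplit : ∀ {B a b t : ℝ}, 0 < B → 0 < t →
      (B * t ^ a) ^ (1 / s) * (B * t ^ b) ^ (1 - 1 / s) =
        B * t ^ (a * (1 / s) + b * (1 - 1 / s)) := by
    intro B a b t hB ht
    rw [Real.mul_rpow hB.le (by positivity), Real.mul_rpow hB.le (by positivity),
      ← Real.rpow_mul ht.le, ← Real.rpow_mul ht.le, Real.rpow_add ht]
    have : B ^ (1 / s) * B ^ (1 - 1 / s) = B := by
      rw [← Real.rpow_add hB, add_sub_cancel, Real.rpow_one]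
    linear_combination t ^ (a * (1 / s)) * t ^ (b * (1 - 1 / s)) * this
  have hnear : ∫⁻ t in Ioc 0 R, ENNReal.ofReal (t ^ (α - D - 1)) *
      (V t ^ (1 / s) * W t ^ (1 - 1 / s)) ≤ ENNReal.ofReal (A * u * (R ^ e / e)) := by
    rw [ENNReal.ofReal_mul (by positivity), ← lintegral_Ioc_rpow_sub_one he0 hR0,
      ← lintegral_const_mul' _ _ ENNReal.ofReal_ne_top]
    refine setLIntegral_mono' measurableSet_Ioc fun t ht ↦ ?_
    have ht0 := ht.1
    calc _ ≤ _ := mul_le_mul_right (rpow_mul_rpow_le_ofReal (by positivity) (by positivity)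
          hθ.le hθ1.le (hVu t ht0) (hWu t ht0)) _
      _ = _ := by
          rw [hsplit (by positivity) ht0, ← ENNReal.ofReal_mul (by positivity),
            ← ENNReal.ofReal_mul (by positivity), mul_left_comm, ← Real.rpow_add ht0]
          congr 3
          rw [he]; ring
  have hfar : ∫⁻ t in Ioi R, ENNReal.ofReal (t ^ (α - D - 1)) *
      (V t ^ (1 / s) * W t ^ (1 - 1 / s)) ≤ ENNReal.ofReal (A * n ^ s * (R ^ (-q) / q)) := by
    rw [ENNReal.ofReal_mul (by positivity), ← lintegral_Ioi_rpow_neg_sub_one hq0 hR0,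
      ← lintegral_const_mul' _ _ ENNReal.ofReal_ne_top]
    refine setLIntegral_mono' measurableSet_Ioi fun t ht ↦ ?_
    have ht0 : 0 < t := hR0.trans ht
    calc _ ≤ _ := mul_le_mul_right (rpow_mul_rpow_le_ofReal (by positivity) (by positivity)
          hθ.le hθ1.le (hVn t ht0) (hWn t ht0)) _
      _ = _ := by
          rw [hsplit (by positivity) ht0, ← ENNReal.ofReal_mul (by positivity),
            ← ENNReal.ofReal_mul (by positivity), mul_left_comm, ← Real.rpow_add ht0]
          congr 3
          rw [hq]; field_simp; ring
  have hRe : u * R ^ e = n * u ^ (1 - 1 / s) := by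
    have : 1 / (α * (s - 1)) * e = 1 / s := by rw [he]; field_simp
    rw [hR, ← Real.rpow_mul (by positivity), this, Real.div_rpow (by positivity) hu.le,
      ← Real.rpow_mul hn.le, mul_one_div_cancel hs0.ne', Real.rpow_one, Real.rpow_sub hu,
      Real.rpow_one]
    ring
  have hRq : n ^ s * R ^ (-q) = n * u ^ (1 - 1 / s) := by
    have : 1 / (α * (s - 1)) * -q = -(1 - 1 / s) := by rw [hq]; field_simp
    rw [hR, ← Real.rpow_mul (by positivity), this, Real.div_rpow (by positivity) hu.le,
      ← Real.rpow_mul hn.le, Real.rpow_neg hu.le,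
      show s * -(1 - 1 / s) = 1 - s by field_simp; ring, Real.rpow_sub hn, Real.rpow_one]
    field_simp
  rw [← Ioc_union_Ioi_eq_Ioi hR0.le, lintegral_union measurableSet_Ioi Ioc_disjoint_Ioi_same]
  refine (add_le_add hnear hfar).trans (le_of_eq ?_)
  rw [← ENNReal.ofReal_add (by positivity) (by positivity)]
  congr 1
  linear_combination A / e * hRe + A / q * hRq

theorem lintegral_ball_rpow_le_of_morreyNorm_ne_top {s : ℝ} (hs : 0 < s)
    {w : EuclideanSpace ℝ (Fin d) → ℝ} (hw : ∀ x, 0 < w x) (hN : morreyNorm d α s w ≠ ⊤)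
    (x : EuclideanSpace ℝ (Fin d)) {t : ℝ} (ht : 0 < t) :
    ∫⁻ y in ball x t, ENNReal.ofReal (w y) ^ s ≤
      ENNReal.ofReal ((morreyNorm d α s w).toReal ^ s * t ^ (d - α * s)) := by
  have h : ENNReal.ofReal t ^ α * (ENNReal.ofReal t ^ (-(d : ℝ)) *
      ∫⁻ y in ball x t, ENNReal.ofReal (w y) ^ s) ^ (1 / s) ≤ morreyNorm d α s w := by
    have hv : ∀ y, ENNReal.ofReal (w y) ^ s = ENNReal.ofReal (|w y| ^ s) := fun y ↦ by
      rw [ENNReal.ofReal_rpow_of_pos (hw y), abs_of_pos (hw y)]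
    simp_rw [hv]
    exact le_iSup_of_le x (le_iSup_of_le t (le_iSup_of_le ht le_rfl))
  have hpow := ENNReal.rpow_le_rpow h hs.le
  rw [ENNReal.mul_rpow_of_nonneg _ _ hs.le, ← ENNReal.rpow_mul, ← ENNReal.rpow_mul,
    one_div_mul_cancel hs.ne', ENNReal.rpow_one, ENNReal.ofReal_rpow_of_pos ht,
    ENNReal.ofReal_rpow_of_pos ht, ← mul_assoc, ← ENNReal.ofReal_mul (by positivity),
    ← Real.rpow_add ht] at hpow
  calc _ = ENNReal.ofReal (t ^ (d - α * s)) * (ENNReal.ofReal (t ^ (α * s + -(d : ℝ))) *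
        ∫⁻ y in ball x t, ENNReal.ofReal (w y) ^ s) := by
        rw [← mul_assoc, ← ENNReal.ofReal_mul (by positivity), ← Real.rpow_add ht]
        ring_nf
        simp
    _ ≤ ENNReal.ofReal (t ^ (d - α * s)) * morreyNorm d α s w ^ s := by gcongr
    _ = _ := by
        rw [mul_comm, ENNReal.ofReal_mul (by positivity),
          ← ENNReal.ofReal_rpow_of_nonneg ENNReal.toReal_nonneg hs.le, ENNReal.ofReal_toReal hN]

theorem lintegral_mul_rpow_le {X : Type*} [MeasurableSpace X] {μ : Measure X} {s : ℝ} (hs : 1 < s)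
    {w U : X → ℝ≥0∞} (hw : Measurable w) (hU : Measurable U) :
    ∫⁻ y, w y * U y ^ (1 - 1 / s) ∂μ ≤
      (∫⁻ y, w y ^ s ∂μ) ^ (1 / s) * (∫⁻ y, U y ∂μ) ^ (1 - 1 / s) := by
  have hc : s.HolderConjugate (s / (s - 1)) := Real.HolderConjugate.conjExponent hs
  have hs0 : s ≠ 0 := by linarith
  have hs1 : s - 1 ≠ 0 := by linarith
  have h1 : 1 / (s / (s - 1)) = 1 - 1 / s := by field_simp
  have h2 : (1 - 1 / s) * (s / (s - 1)) = 1 := by field_simp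
  have h := ENNReal.lintegral_mul_le_Lp_mul_Lq μ hc hw.aemeasurable
    (hU.pow_const (1 - 1 / s)).aemeasurable
  simpa only [Pi.mul_apply, ← ENNReal.rpow_mul, h1, h2, ENNReal.rpow_one] using h

/-- Schur's test with a single positive test function. -/
theorem lintegral_sq_le_of_schur {X : Type*} [MeasurableSpace X] {μ : Measure X} [SFinite μ]
    {k : X → X → ℝ≥0∞} (hk : Measurable (Function.uncurry k)) (hsymm : ∀ x y, k x y = k y x)
    {w u g : X → ℝ≥0∞} (hw : Measurable w) (hu : Measurable u) (hg : Measurable g)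
    (hw0 : ∀ x, w x ≠ 0) (hwt : ∀ x, w x ≠ ⊤) (hu0 : ∀ x, u x ≠ 0) (hut : ∀ᵐ x ∂μ, u x ≠ ⊤)
    {B : ℝ≥0∞} (hB : ∀ x, ∫⁻ y, k x y * (w y * u y) ∂μ ≤ B * u x) :
    ∫⁻ x, (∫⁻ y, k x y * g y ∂μ) ^ 2 * w x ∂μ ≤ B ^ 2 * ∫⁻ x, g x ^ 2 * (w x)⁻¹ ∂μ := by
  have hkx : ∀ x, Measurable (k x) := fun x ↦ hk.comp measurable_prodMk_left
  set h : X → ℝ≥0∞ := fun y ↦ g y ^ 2 * (w y * u y)⁻¹ with hh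
  have hhm : Measurable h := (hg.pow_const 2).mul (hw.mul hu).inv
  have hkhm : ∀ x, Measurable fun y ↦ k x y * h y := fun x ↦ (hkx x).mul hhm
  have hkwu : ∀ x, Measurable fun y ↦ k x y * (w y * u y) := fun x ↦ (hkx x).mul (hw.mul hu)
  have hCS : ∀ x, (∫⁻ y, k x y * g y ∂μ) ^ 2 ≤
      (∫⁻ y, k x y * (w y * u y) ∂μ) * ∫⁻ y, k x y * h y ∂μ := by
    intro x
    have H := ENNReal.lintegral_mul_le_Lp_mul_Lq μ Real.HolderConjugate.two_two
      ((hkwu x).pow_const (1 / 2 : ℝ)).aemeasurable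
      ((hkhm x).pow_const (1 / 2 : ℝ)).aemeasurable
    simp only [Pi.mul_apply, ← ENNReal.rpow_mul, one_div, ENNReal.rpow_one,
      inv_mul_cancel₀ (two_ne_zero (α := ℝ))] at H
    have hpt : ∫⁻ y, k x y * g y ∂μ =
        ∫⁻ y, (k x y * (w y * u y)) ^ (2⁻¹ : ℝ) * (k x y * h y) ^ (2⁻¹ : ℝ) ∂μ := by
      refine lintegral_congr_ae ?_
      filter_upwards [hut] with y hy
      rw [← ENNReal.mul_rpow_of_nonneg _ _ (by norm_num)]
      have : k x y * (w y * u y) * (k x y * h y) = (k x y * g y) ^ (2 : ℝ) := by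
        rw [ENNReal.rpow_two]
        calc _ = (k x y * g y) ^ 2 * ((w y * u y) * (w y * u y)⁻¹) := by rw [hh]; ring
          _ = _ := by
            rw [ENNReal.mul_inv_cancel (mul_ne_zero (hw0 y) (hu0 y))
              (ENNReal.mul_ne_top (hwt y) hy), mul_one]
      rw [this, ← ENNReal.rpow_mul]
      simp
    rw [hpt, ← ENNReal.rpow_two]
    refine (ENNReal.rpow_le_rpow H two_pos.le).trans (le_of_eq ?_)
    rw [← ENNReal.mul_rpow_of_nonneg _ _ (by norm_num), ← ENNReal.rpow_mul]
    simp
  have hm : Measurable (Function.uncurry fun x y ↦ w x * u x * (k x y * h y)) :=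
    ((hw.mul hu).comp measurable_fst).mul (hk.mul (hhm.comp measurable_snd))
  calc ∫⁻ x, (∫⁻ y, k x y * g y ∂μ) ^ 2 * w x ∂μ
      ≤ ∫⁻ x, B * ∫⁻ y, w x * u x * (k x y * h y) ∂μ ∂μ := by
        refine lintegral_mono fun x ↦ ?_
        rw [lintegral_const_mul _ (hkhm x)]
        calc _ ≤ (B * u x * ∫⁻ y, k x y * h y ∂μ) * w x := by
              gcongr
              exact (hCS x).trans (by gcongr; exact hB x)
          _ = _ := by ring
    _ = B * ∫⁻ y, ∫⁻ x, w x * u x * (k x y * h y) ∂μ ∂μ := by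
        have hm' : Measurable fun x ↦ ∫⁻ y, w x * u x * (k x y * h y) ∂μ :=
          hm.lintegral_prod_right'
        rw [lintegral_const_mul _ hm',
          lintegral_lintegral_swap hm.aemeasurable]
    _ ≤ B * ∫⁻ y, B * (g y ^ 2 * (w y)⁻¹) ∂μ := by
        gcongr with y
        calc ∫⁻ x, w x * u x * (k x y * h y) ∂μ
            = h y * ∫⁻ x, k y x * (w x * u x) ∂μ := by
              rw [← lintegral_const_mul _ (hkwu y)]
              refine lintegral_congr fun x ↦ ?_
              rw [hsymm x y]; ring
          _ ≤ h y * (B * u y) := by gcongr; exact hB y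
          _ = B * (g y ^ 2 * (w y)⁻¹) * ((u y)⁻¹ * u y) := by
              rw [hh]
              simp only
              rw [ENNReal.mul_inv (Or.inl (hw0 y)) (Or.inl (hwt y))]
              ring
          _ ≤ B * (g y ^ 2 * (w y)⁻¹) * 1 := by gcongr; exact ENNReal.inv_mul_le_one _
          _ = _ := mul_one _
    _ = _ := by
        rw [lintegral_const_mul _ (by fun_prop)]
        ring

theorem exists_riesz_lintegral_le_of_morreyNorm {s : ℝ} (hα : 0 < α) (hαd : α < d) (hs : 1 < s) :
    ∃ C : ℝ, 0 < C ∧ ∀ w : EuclideanSpace ℝ (Fin d) → ℝ, Measurable w → (∀ x, 0 < w x) →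
      morreyNorm d α s w ≠ ⊤ →
      ∃ u : EuclideanSpace ℝ (Fin d) → ℝ≥0∞, Measurable u ∧ (∀ x, u x ≠ 0) ∧ (∀ᵐ x, u x ≠ ⊤) ∧
        ∀ x, ∫⁻ y, ENNReal.ofReal (‖x - y‖ ^ (-(d : ℝ) + α)) * (ENNReal.ofReal (w y) * u y) ≤
          ENNReal.ofReal C * morreyNorm d α s w * u x := by
  have hs0 : 0 < s := one_pos.trans hs
  have hs1 : 0 < s - 1 := sub_pos.2 hs
  have hp := sub_pos.2 hαd
  have hθ' : 0 < 1 - 1 / s := by rw [sub_pos, div_lt_one hs0]; exact hs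
  obtain ⟨C₁, hC₁, H₁⟩ := exists_lintegral_ball_layerPotential_le_mul (d := d) hα hαd
  obtain ⟨C₂, hC₂, H₂⟩ := exists_lintegral_ball_layerPotential_le_rpow (d := d) hα
    (lt_mul_of_one_lt_right hα hs)
  set A : ℝ := 1 + (d - α) + C₁ + C₂
  set K : ℝ := A * (1 / (α * (1 - 1 / s)) + 1 / (α * (s - 1) * (1 - 1 / s)))
  have hA0 : 0 < A := by positivity
  have hK0 : 0 < K := by positivity
  refine ⟨(d - α) * K, by positivity, fun w hw hw0 hN ↦ ?_⟩
  set N := morreyNorm d α s w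
  set v : EuclideanSpace ℝ (Fin d) → ℝ≥0∞ := fun y ↦ ENNReal.ofReal (w y) ^ s
  have hwm : Measurable fun y ↦ ENNReal.ofReal (w y) := hw.ennreal_ofReal
  have hvm : Measurable v := hwm.pow_const s
  have hv0 : ∀ y, v y ≠ 0 := fun y ↦
    (ENNReal.rpow_pos (ENNReal.ofReal_pos.2 (hw0 y)) ENNReal.ofReal_ne_top).ne'
  have hball : ∀ x t, 0 < t → ∫⁻ y in ball x t, v y ≤
      ENNReal.ofReal (N.toReal ^ s * t ^ (d - α * s)) := fun x t ht ↦
    lintegral_ball_rpow_le_of_morreyNorm_ne_top hs0 hw0 hN x ht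
  have hpos : ∀ x t, 0 < t → 0 < ∫⁻ y in ball x t, v y := fun x t ht ↦ by
    rw [lintegral_pos_iff_support hvm, Function.support_eq_univ hv0,
      Measure.restrict_apply_univ]
    exact measure_ball_pos _ _ ht
  have hn : 0 < N.toReal := by
    refine lt_of_le_of_ne ENNReal.toReal_nonneg fun h ↦ ?_
    have h1 := (hpos 0 1 one_pos).trans_le (hball 0 1 one_pos)
    rw [← h, Real.zero_rpow hs0.ne', zero_mul, ENNReal.ofReal_zero] at h1
    exact lt_irrefl _ h1
  set U := layerPotential d α v with hU
  have hUm : Measurable U := measurable_layerPotential hvm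
  have hU0 : ∀ x, U x ≠ 0 := fun x h ↦ by
    have h1 := (hpos x 1 one_pos).trans_le
      (lintegral_ball_le_layerPotential (v := v) hαd x one_pos)
    rw [← hU, h, mul_zero] at h1
    exact lt_irrefl _ h1
  have hUball : ∀ x t, 0 < t → ∫⁻ y in ball x t, U y ≤
      ENNReal.ofReal (C₂ * N.toReal ^ s * t ^ (d + α - α * s)) :=
    H₂ v hvm _ (by positivity) hball
  have hUt : ∀ᵐ x, U x ≠ ⊤ := by
    rw [← Measure.restrict_univ (μ := (volume : Measure (EuclideanSpace ℝ (Fin d)))),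
      ← iUnion_ball_nat_succ (0 : EuclideanSpace ℝ (Fin d)), ae_restrict_iUnion_iff]
    intro m
    filter_upwards [ae_lt_top hUm
      ((hUball 0 (m + 1) (by positivity)).trans_lt ENNReal.ofReal_lt_top).ne] with x hx
    exact hx.ne
  refine ⟨fun x ↦ U x ^ (1 - 1 / s), hUm.pow_const _, fun x ↦ ?_, ?_, fun x ↦ ?_⟩
  · exact (ENNReal.rpow_pos_of_nonneg (pos_iff_ne_zero.2 (hU0 x)) hθ'.le).ne'
  · filter_upwards [hUt] with x hx
    exact ENNReal.rpow_ne_top_of_nonneg hθ'.le hx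
  rcases eq_or_ne (U x) ⊤ with hx | hx
  · have hC : ENNReal.ofReal ((d - α) * K) * N ≠ 0 :=
      mul_ne_zero (ENNReal.ofReal_pos.2 (by positivity)).ne' (ENNReal.toReal_pos_iff.1 hn).1.ne'
    simp only [hx, ENNReal.top_rpow_of_pos hθ', ENNReal.mul_top hC, le_top]
  have hu : 0 < (U x).toReal := ENNReal.toReal_pos (hU0 x) hx
  have hscale : ∀ {a b c : ℝ}, a ≤ A → 0 ≤ b → 0 ≤ c →
      ENNReal.ofReal (a * b * c) ≤ ENNReal.ofReal (A * b * c) := fun ha hb hc ↦ by gcongr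
  have hmain := lintegral_rpow_mul_le_of_growth (D := d) hα hs hA0 hn hu
    (V := fun t ↦ ∫⁻ y in ball x t, v y) (W := fun t ↦ ∫⁻ y in ball x t, U y)
    (fun t ht ↦ (hball x t ht).trans (by
      rw [← one_mul (N.toReal ^ s)]
      exact (hscale (by linarith) (by positivity) (by positivity)).trans_eq (by rw [one_mul])))
    (fun t ht ↦ (lintegral_ball_le_layerPotential hαd x ht).trans (by
      rw [← hU, ← ENNReal.ofReal_toReal hx, ← ENNReal.ofReal_mul (by positivity),
        mul_right_comm, ENNReal.toReal_ofReal hu.le]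
      exact hscale (by linarith) hu.le (by positivity)))
    (fun t ht ↦ (hUball x t ht).trans (hscale (by linarith) (by positivity) (by positivity)))
    (fun t ht ↦ (H₁ v hvm x t ht).trans (by
      rw [← hU, ← ENNReal.ofReal_toReal hx, ← ENNReal.ofReal_mul (by positivity),
        mul_right_comm, ENNReal.toReal_ofReal hu.le]
      exact hscale (by linarith) hu.le (by positivity)))
  calc _ ≤ ENNReal.ofReal (d - α) *
        layerPotential d α (fun y ↦ ENNReal.ofReal (w y) * U y ^ (1 - 1 / s)) x :=
        lintegral_rpow_mul_le_layerPotential hαd (hwm.mul (hUm.pow_const _)) x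
    _ ≤ ENNReal.ofReal (d - α) * ENNReal.ofReal (K * N.toReal * (U x).toReal ^ (1 - 1 / s)) := by
        gcongr
        refine le_trans (lintegral_mono fun t ↦ ?_) hmain
        gcongr
        exact lintegral_mul_rpow_le hs hwm hUm
    _ = _ := by
        rw [← ENNReal.ofReal_mul hp.le, ← mul_assoc, ← mul_assoc,
          ENNReal.ofReal_mul (by positivity), ENNReal.ofReal_mul (by positivity),
          ENNReal.ofReal_toReal hN, ← ENNReal.ofReal_rpow_of_nonneg hu.le hθ'.le,
          ENNReal.ofReal_toReal hx]

end

theorem riesz_potential_weighted_bound (d : ℕ) (hd : 1 ≤ d) (α s : ℝ)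
    (hα0 : 0 < α) (hαd : α < d) (hs1 : 1 < s) (hs2 : s ≤ (d : ℝ) / α) :
    ∃ C : ℝ, 0 < C ∧ ∀ w : EuclideanSpace ℝ (Fin d) → ℝ, Measurable w →
      (∀ x, 0 < w x) → morreyNorm d α s w ≠ ⊤ →
      ∀ f : EuclideanSpace ℝ (Fin d) → ℂ, Measurable f →
        (∫⁻ x, (‖f x‖₊ : ℝ≥0∞) ^ 2 * (ENNReal.ofReal (w x))⁻¹) ≠ ⊤ →
        (∫⁻ x, (‖rieszPotential d α f x‖₊ : ℝ≥0∞) ^ 2 * ENNReal.ofReal (w x)) ^ ((1 : ℝ) / 2)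
          ≤ ENNReal.ofReal C * morreyNorm d α s w *
            (∫⁻ x, (‖f x‖₊ : ℝ≥0∞) ^ 2 * (ENNReal.ofReal (w x))⁻¹) ^ ((1 : ℝ) / 2) := by
  obtain ⟨C, hC, H⟩ := exists_riesz_lintegral_le_of_morreyNorm (d := d) hα0 hαd hs1
  refine ⟨C, hC, fun w hw hw0 hN f hf _ ↦ ?_⟩
  obtain ⟨u, hum, hu0, hut, hu⟩ := H w hw hw0 hN
  have hk : Measurable (Function.uncurry fun x y : EuclideanSpace ℝ (Fin d) ↦
      ENNReal.ofReal (‖x - y‖ ^ (-(d : ℝ) + α))) := by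
    refine (Measurable.pow_const ?_ _).ennreal_ofReal
    exact (measurable_fst.sub measurable_snd).norm
  have hschur := lintegral_sq_le_of_schur hk (fun x y ↦ by rw [norm_sub_rev]) hw.ennreal_ofReal hum
    (g := fun y ↦ (‖f y‖₊ : ℝ≥0∞)) hf.nnnorm.coe_nnreal_ennreal
    (fun x ↦ (ENNReal.ofReal_pos.2 (hw0 x)).ne') (fun x ↦ ENNReal.ofReal_ne_top) hu0 hut hu
  have hriesz : ∀ x, (‖rieszPotential d α f x‖₊ : ℝ≥0∞) ≤
      ∫⁻ y, ENNReal.ofReal (‖x - y‖ ^ (-(d : ℝ) + α)) * (‖f y‖₊ : ℝ≥0∞) := fun x ↦ by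
    refine (enorm_integral_le_lintegral_enorm _).trans_eq (lintegral_congr fun y ↦ ?_)
    rw [enorm_mul, ← ofReal_norm, Complex.norm_real, Real.norm_of_nonneg (by positivity)]
    rfl
  calc _ ≤ ((ENNReal.ofReal C * morreyNorm d α s w) ^ 2 *
        ∫⁻ x, (‖f x‖₊ : ℝ≥0∞) ^ 2 * (ENNReal.ofReal (w x))⁻¹) ^ ((1 : ℝ) / 2) := by
        gcongr
        refine le_trans (lintegral_mono fun x ↦ ?_) hschur
        gcongr
        exact hriesz x
    _ = _ := by
        rw [ENNReal.mul_rpow_of_nonneg _ _ (by norm_num), ← ENNReal.rpow_two, ← ENNReal.rpow_mul,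
          mul_one_div_cancel two_ne_zero, ENNReal.rpow_one]
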